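/- arXiv:2012.15634 — 3 statements merged into one kernel-verified Lean document; each statement's English description precedes it below -/
import Mathlib

section
/- Let β ∈ C^1(G,ℤ) and h: E → ℤ≥0 satisfy |∑_{e∈E^𝔬} β_e γ_e| ≤ ∑_{e∈E^𝔬} h(e)|γ_e| for every γ ∈ H^1(G,ℤ). Let A ⊆ 𝔼 be the set of oriented edges e for which there exists an oriented cycle γ in G containing e with ∑_{f∈γ} β_f = ∑_{f∈γ} h(f) (where h(f) denotes the value of h on the underlying edge of f). Then for every oriented edge e with h(e) > 0, at most one of e and ē belongs to A. -/
open scoped Classical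

/-- A finite loopless multigraph presented by its set of *oriented* edges:
each edge gives rise to two oriented edges, swapped by the fixed-point-free
involution `rev`. -/
structure OrGraph where
  V : Type
  EO : Type
  fintV : Fintype V
  fintEO : Fintype EO
  decV : DecidableEq V
  decEO : DecidableEq EO
  rev : EO → EO
  tail : EO → V
  head : EO → V
  rev_rev : ∀ e, rev (rev e) = e
  rev_ne : ∀ e, rev e ≠ e
  head_rev : ∀ e, head (rev e) = tail e
  tail_rev : ∀ e, tail (rev e) = head e

attribute [instance] OrGraph.fintV OrGraph.fintEO OrGraph.decV OrGraph.decEO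

namespace OrGraph

variable (G : OrGraph)

/-- Adjacency: there is an oriented edge from `u` to `v`. -/
def Adj (u v : G.V) : Prop := ∃ e, G.tail e = u ∧ G.head e = v

/-- The graph is connected. -/
def Connected : Prop := ∀ u v : G.V, Relation.ReflTransGen G.Adj u v

/-- `g : 𝔼 → A` is a 1-cochain, i.e. `g(ē) = -g(e)`. -/
def IsC1 {A : Type} [Neg A] (g : G.EO → A) : Prop := ∀ e, g (G.rev e) = - g e

/-- The differential `d : C^0(G,A) → C^1(G,A)`, `d(f)(uv) = f(v) - f(u)`. -/
def d {A : Type} [Sub A] (f : G.V → A) : G.EO → A :=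
  fun e => f (G.head e) - f (G.tail e)

/-- The adjoint `d* : C^1(G,A) → C^0(G,A)`, `d*(g)(v) = ∑_{head e = v} g(e)`. -/
def dstar {A : Type} [AddCommMonoid A] (g : G.EO → A) : G.V → A :=
  fun v => ∑ e ∈ Finset.univ.filter (fun e => G.head e = v), g e

/-- The 1-cochain `χ_e - χ_ē`: value `1` at `e`, `-1` at `ē`, `0` elsewhere. -/
def chi (A : Type) [Zero A] [One A] [Neg A] (e : G.EO) : G.EO → A :=
  fun f => if f = e then 1 else if f = G.rev e then -1 else 0

/-- The set `S ⊆ V` induces a connected subgraph. -/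
def ConnectedOn (S : Set G.V) : Prop :=
  ∀ u ∈ S, ∀ v ∈ S,
    Relation.ReflTransGen (fun a b => a ∈ S ∧ b ∈ S ∧ G.Adj a b) u v

/-- `β` is a bond element: `β = d(χ_X)` with `X` nonempty, proper, and both
`G[X]` and `G[V-X]` connected. -/
def IsBond (β : G.EO → ℝ) : Prop :=
  ∃ X : Finset G.V, X.Nonempty ∧ Xᶜ.Nonempty ∧
    G.ConnectedOn ↑X ∧ G.ConnectedOn ↑(Xᶜ) ∧
    β = G.d (fun v => if v ∈ X then (1 : ℝ) else 0)

/-- The positive support of a real 1-cochain. -/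
def suppPlus (x : G.EO → ℝ) : Set G.EO := {e | 0 < x e}

/-- The cone generated by a set of vectors: all finite nonnegative combinations. -/
def coneGen (S : Set (G.EO → ℝ)) : Set (G.EO → ℝ) :=
  { x | ∃ (t : Finset (G.EO → ℝ)) (c : (G.EO → ℝ) → ℝ),
      (∀ y ∈ t, y ∈ S) ∧ (∀ y ∈ t, 0 ≤ c y) ∧ x = ∑ y ∈ t, c y • y }

/-- `D ⊆ 𝔼` is a coherent acyclic orientation of a cut subgraph of `G`:
for some ordered partition of `V` (encoded by `r : V → ℕ`), `D` consists of
the oriented edges going from a smaller part to a bigger part. -/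
def IsCAC (D : Set G.EO) : Prop :=
  ∃ r : G.V → ℕ, D = {e | r (G.tail e) < r (G.head e)}

/-- The cone `σ_D` generated by the bond elements with positive support in `D`. -/
def bondCone (D : Set G.EO) : Set (G.EO → ℝ) :=
  G.coneGen {β | G.IsBond β ∧ G.suppPlus β ⊆ D}

/-- The cone `σ_{𝔼(D)}` generated by the `χ_e - χ_ē` for `e ∈ D`. -/
def edgeCone (D : Set G.EO) : Set (G.EO → ℝ) :=
  G.coneGen {x | ∃ e ∈ D, x = G.chi ℝ e}

/-- The cut space `F_ℝ`, the image of `d : C^0(G,ℝ) → C^1(G,ℝ)`. -/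
def cutSpace : Set (G.EO → ℝ) := {x | ∃ f : G.V → ℝ, x = G.d f}

/-- `γ` is an oriented cycle: a nonempty cyclic sequence of oriented edges with
pairwise distinct underlying edges, the head of each being the tail of the next. -/
def IsCycle (γ : List G.EO) : Prop :=
  γ ≠ [] ∧
  (∀ i : Fin γ.length,
    G.head (γ.get i) = G.tail (γ.get ⟨((i : ℕ) + 1) % γ.length, Nat.mod_lt _ i.pos⟩)) ∧
  (∀ i j : Fin γ.length, i ≠ j → γ.get i ≠ γ.get j ∧ γ.get i ≠ G.rev (γ.get j))

/-- `δ^{𝔪,n}_e(f) = ⌊(f(head e) - f(tail e) + n 𝔪_e)/(n ℓ_e)⌋`. -/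
def ddelta (ℓ : G.EO → ℕ) (m : G.EO → ℤ) (n : ℕ) (f : G.V → ℤ) (e : G.EO) : ℤ :=
  ⌊((f (G.head e) : ℚ) - (f (G.tail e) : ℚ) + (n : ℚ) * (m e : ℚ)) /
    ((n : ℚ) * (ℓ e : ℚ))⌋

/-- `𝔡^{𝔪,n}_f(e) = (δ^{𝔪,n}_e(f) - δ^{𝔪,n}_{ē}(f))/2`. -/
def dd (ℓ : G.EO → ℕ) (m : G.EO → ℤ) (n : ℕ) (f : G.V → ℤ) (e : G.EO) : ℚ :=
  ((G.ddelta ℓ m n f e : ℚ) - (G.ddelta ℓ m n f (G.rev e) : ℚ)) / 2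

end OrGraph

namespace OrGraph

lemma sum_map_eq_sum_count {α : Type} [Fintype α] [DecidableEq α] (l : List α) (φ : α → ℤ) :
    (l.map φ).sum = ∑ f, (l.count f : ℤ) * φ f := by
  induction l with
  | nil => simp
  | cons a l ih =>
    simp only [List.map_cons, List.sum_cons, ih, List.count_cons, Nat.cast_add, add_mul,
      Finset.sum_add_distrib]
    simp [add_comm]

variable (G : OrGraph)

lemma sum_rev (F : G.EO → ℤ) : ∑ f, F (G.rev f) = ∑ f, F f :=
  Equiv.sum_comp (Function.Involutive.toPerm G.rev G.rev_rev) F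

/-- Summing over an orientation the contributions of both directions gives the sum over all
oriented edges. -/
lemma sum_orientation (O : Finset G.EO) (hO : ∀ e, e ∈ O ↔ G.rev e ∉ O) (F : G.EO → ℤ) :
    ∑ f ∈ O, (F f + F (G.rev f)) = ∑ f, F f := by
  have hcompl : ∑ f ∈ O, F (G.rev f) = ∑ f ∈ Oᶜ, F f := by
    refine Finset.sum_bij' (fun f _ => G.rev f) (fun f _ => G.rev f) ?_ ?_ ?_ ?_ ?_
    · intro f hf
      simpa using (hO f).1 hf
    · intro f hf
      by_contra hcon
      exact (Finset.mem_compl.1 hf) ((hO f).2 hcon)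
    · simp [G.rev_rev]
    · simp [G.rev_rev]
    · simp
  rw [Finset.sum_add_distrib, hcompl, Finset.sum_add_sum_compl]

/-- The heads along an oriented cycle are a rotation of the tails. -/
lemma IsCycle.perm_head_tail {G : OrGraph} {γ : List G.EO} (hγ : G.IsCycle γ) :
    (γ.map G.head).Perm (γ.map G.tail) := by
  have hrot : γ.map G.head = (γ.map G.tail).rotate 1 := by
    refine List.ext_getElem (by simp) fun i hi _ => ?_
    have := hγ.2.1 ⟨i, by simpa using hi⟩
    simpa [List.getElem_rotate] using this
  rw [hrot]
  exact List.rotate_perm _ _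

/-- The 1-cochain counting signed passages of a list of oriented edges. -/
def signedCount (l : List G.EO) (f : G.EO) : ℤ := l.count f - l.count (G.rev f)

lemma isC1_signedCount (l : List G.EO) : G.IsC1 (G.signedCount l) := by
  intro f
  simp [signedCount, G.rev_rev]

lemma dstar_signedCount {l : List G.EO} (hl : (l.map G.head).Perm (l.map G.tail)) :
    G.dstar (G.signedCount l) = 0 := by
  funext v
  have hsum := (hl.map fun w => if w = v then (1 : ℤ) else 0).sum_eq
  rw [List.map_map, List.map_map, sum_map_eq_sum_count, sum_map_eq_sum_count,
    ← G.sum_rev fun f => (l.count f : ℤ) * ((fun w => if w = v then (1 : ℤ) else 0) ∘ G.tail) f]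
    at hsum
  simp only [Function.comp_apply, G.tail_rev, mul_ite, mul_one, mul_zero] at hsum
  simp only [dstar, signedCount, Finset.sum_filter, Pi.zero_apply]
  rw [← sub_eq_zero, ← Finset.sum_sub_distrib] at hsum
  refine Eq.trans (Finset.sum_congr rfl fun f _ => ?_) hsum
  split_ifs <;> simp

end OrGraph

/-- with `A` the set of oriented edges lying on a cycle `γ` with
`∑_{f∈γ} β_f = ∑_{f∈γ} h(f)`, for every edge with `h(e) > 0` at most one of
`e`, `ē` belongs to `A`. -/
theorem at_most_one_orientation_in_A (G : OrGraph) (hconn : G.Connected)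
    (O : Finset G.EO) (hO : ∀ e, e ∈ O ↔ G.rev e ∉ O)
    (β : G.EO → ℤ) (hβ : G.IsC1 β)
    (h : G.EO → ℤ) (hsym : ∀ e, h (G.rev e) = h e) (hpos : ∀ e, 0 ≤ h e)
    (hineq : ∀ γ : G.EO → ℤ, G.IsC1 γ → G.dstar γ = 0 →
      |∑ e ∈ O, β e * γ e| ≤ ∑ e ∈ O, h e * |γ e|) :
    ∀ e : G.EO, 0 < h e →
      ¬((∃ γ : List G.EO, G.IsCycle γ ∧ e ∈ γ ∧ (γ.map β).sum = (γ.map h).sum) ∧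
        (∃ γ : List G.EO, G.IsCycle γ ∧ G.rev e ∈ γ ∧
          (γ.map β).sum = (γ.map h).sum)) := by
  rintro e he ⟨⟨γ₁, hγ₁, he₁, hs₁⟩, γ₂, hγ₂, he₂, hs₂⟩
  set l := γ₁ ++ γ₂ with hl
  have hperm : (l.map G.head).Perm (l.map G.tail) := by
    simpa [hl] using hγ₁.perm_head_tail.append hγ₂.perm_head_tail
  have hle := (le_abs_self _).trans
    (hineq _ (G.isC1_signedCount l) (G.dstar_signedCount hperm))
  have hsum : (l.map β).sum = (l.map h).sum := by simp [hl, hs₁, hs₂]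
  rw [OrGraph.sum_map_eq_sum_count, OrGraph.sum_map_eq_sum_count,
    ← G.sum_orientation O hO, ← G.sum_orientation O hO] at hsum
  have hβsum : ∑ f ∈ O, β f * G.signedCount l f =
      ∑ f ∈ O, ((l.count f : ℤ) * β f + (l.count (G.rev f) : ℤ) * β (G.rev f)) := by
    refine Finset.sum_congr rfl fun f _ => ?_
    rw [hβ f, OrGraph.signedCount]
    ring
  rw [hβsum, hsum] at hle
  have hterm : ∀ f, h f * |G.signedCount l f| ≤
      (l.count f : ℤ) * h f + (l.count (G.rev f) : ℤ) * h (G.rev f) := by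
    intro f
    have habs : |G.signedCount l f| ≤ (l.count f : ℤ) + l.count (G.rev f) := by
      rw [OrGraph.signedCount, abs_le]
      constructor <;> linarith [Int.natCast_nonneg (l.count f),
        Int.natCast_nonneg (l.count (G.rev f))]
    rw [hsym f]
    nlinarith [hpos f]
  have hstrict : ∀ f, 0 < h f → f ∈ l → G.rev f ∈ l → h f * |G.signedCount l f| <
      (l.count f : ℤ) * h f + (l.count (G.rev f) : ℤ) * h (G.rev f) := by
    intro f hf hfl hrl
    have habs : |G.signedCount l f| < (l.count f : ℤ) + l.count (G.rev f) := by
      have h₁ : (0 : ℤ) < l.count f := by exact_mod_cast List.count_pos_iff.2 hfl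
      have h₂ : (0 : ℤ) < l.count (G.rev f) := by exact_mod_cast List.count_pos_iff.2 hrl
      rw [OrGraph.signedCount, abs_lt]
      constructor <;> linarith
    rw [hsym f]
    nlinarith
  have hel : e ∈ l := List.mem_append_left _ he₁
  have hrl : G.rev e ∈ l := List.mem_append_right _ he₂
  refine absurd hle (not_le.2 (Finset.sum_lt_sum (fun f _ => hterm f) ?_))
  by_cases heO : e ∈ O
  · exact ⟨e, heO, hstrict e he hel hrl⟩
  · refine ⟨G.rev e, ?_, hstrict _ (by rwa [hsym]) hrl (by rwa [G.rev_rev])⟩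
    by_contra hcon
    exact heO ((hO e).2 hcon)
end

section
/- Let β ∈ C^1(G,ℤ) and h: E → ℤ≥0 satisfy |∑_{e∈E^𝔬} β_e γ_e| ≤ ∑_{e∈E^𝔬} h(e)|γ_e| for every γ ∈ H^1(G,ℤ). Let A ⊆ 𝔼 be the set of oriented edges e for which there exists an oriented cycle γ in G containing e with ∑_{f∈γ} β_f = ∑_{f∈γ} h(f). Assume moreover that every oriented edge e with h(e) > 0 satisfies e ∈ A or ē ∈ A. Define η ∈ C^1(G,ℤ) by η_e = h(e) if e ∈ A and h(e) > 0, η_e = −h(e) if ē ∈ A and h(e) > 0, and η_e = 0 otherwise (this is well defined by the preceding dichotomy). Then ∑_{e∈E^𝔬} β_e γ_e = ∑_{e∈E^𝔬} η_e γ_e for every γ ∈ H^1(G,ℤ). -/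
open scoped Classical

namespace OrGraph

variable {G : OrGraph}

lemma sum_eq_sum_orientation {O : Finset G.EO} (hO : ∀ e, e ∈ O ↔ G.rev e ∉ O)
    (F : G.EO → ℤ) : ∑ e, F e = ∑ e ∈ O, (F e + F (G.rev e)) := by
  rw [Finset.sum_add_distrib, ← Finset.sum_add_sum_compl O F]
  congr 1
  refine Finset.sum_bij' (fun e _ => G.rev e) (fun e _ => G.rev e) ?_ ?_ ?_ ?_ ?_
  · intro e he
    rw [hO, G.rev_rev]
    simpa using he
  · intro e he
    simpa using (hO e).1 he
  all_goals simp [G.rev_rev]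

lemma sum_comp_rev (F : G.EO → ℤ) : ∑ e, F (G.rev e) = ∑ e, F e :=
  Equiv.sum_comp (Function.Involutive.toPerm G.rev G.rev_rev) F

/-- `G.IsWalk u v m`: some walk from `u` to `v` traverses each oriented edge `e` exactly
`m e` times. -/
inductive IsWalk (G : OrGraph) (u : G.V) : G.V → (G.EO → ℤ) → Prop
  | nil : IsWalk G u u 0
  | snoc {m : G.EO → ℤ} (e : G.EO) :
      IsWalk G u (G.tail e) m → IsWalk G u (G.head e) (m + Pi.single e 1)

lemma IsWalk.trans {u v w : G.V} {m n : G.EO → ℤ} (hm : G.IsWalk u v m)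
    (hn : G.IsWalk v w n) : G.IsWalk u w (m + n) := by
  induction hn with
  | nil => simpa using hm
  | snoc e _ ih => simpa only [add_assoc] using ih.snoc e

lemma IsWalk.nonneg {u v : G.V} {m : G.EO → ℤ} (hm : G.IsWalk u v m) (e : G.EO) :
    0 ≤ m e := by
  induction hm with
  | nil => simp
  | snoc f _ ih =>
    have : 0 ≤ (Pi.single f 1 : G.EO → ℤ) e := by
      rw [Pi.single_apply]
      split_ifs <;> simp
    simpa using add_nonneg ih this

lemma IsWalk.sum_mul_d {u v : G.V} {m : G.EO → ℤ} (hm : G.IsWalk u v m) (f : G.V → ℤ) :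
    ∑ e, m e * G.d f e = f v - f u := by
  induction hm with
  | nil => simp
  | snoc e _ ih =>
    simp only [Pi.add_apply, add_mul, Finset.sum_add_distrib, ih]
    simp [Pi.single_apply, d]

lemma Connected.exists_isWalk (hconn : G.Connected) (u v : G.V) : ∃ m, G.IsWalk u v m := by
  induction hconn u v with
  | refl => exact ⟨0, .nil⟩
  | tail _ hadj ih =>
    obtain ⟨m, hm⟩ := ih
    obtain ⟨e, rfl, rfl⟩ := hadj
    exact ⟨_, hm.snoc e⟩

/-- The antisymmetrization of the edge multiplicities of a closed walk is a cycle. -/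
lemma IsWalk.dstar_eq_zero {u : G.V} {m : G.EO → ℤ} (hm : G.IsWalk u u m) :
    G.dstar (fun e => m e - m (G.rev e)) = 0 := by
  funext x
  have h0 := hm.sum_mul_d (fun v => if v = x then 1 else 0)
  have h1 := sum_comp_rev (fun e => m e * if G.tail e = x then 1 else 0)
  simp only [d, mul_sub, Finset.sum_sub_distrib, sub_self] at h0
  simp only [G.tail_rev] at h1
  rw [← h1, ← Finset.sum_sub_distrib] at h0
  rw [dstar, Finset.sum_filter]
  refine (Finset.sum_congr rfl fun e _ => ?_).trans h0
  split_ifs <;> simp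

lemma IsWalk.sum_le_sum {O : Finset G.EO} (hO : ∀ e, e ∈ O ↔ G.rev e ∉ O)
    {β h : G.EO → ℤ} (hβ : G.IsC1 β) (hsym : ∀ e, h (G.rev e) = h e) (hpos : ∀ e, 0 ≤ h e)
    (hineq : ∀ γ : G.EO → ℤ, G.IsC1 γ → G.dstar γ = 0 →
      |∑ e ∈ O, β e * γ e| ≤ ∑ e ∈ O, h e * |γ e|)
    {u : G.V} {m : G.EO → ℤ} (hm : G.IsWalk u u m) :
    ∑ e, m e * β e ≤ ∑ e, m e * h e := by
  have hγ : G.IsC1 (fun e => m e - m (G.rev e)) := fun e => by simp [G.rev_rev]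
  calc ∑ e, m e * β e = ∑ e ∈ O, β e * (m e - m (G.rev e)) := by
        rw [sum_eq_sum_orientation hO]
        refine Finset.sum_congr rfl fun e _ => ?_
        rw [hβ e]
        ring
    _ ≤ ∑ e ∈ O, h e * |m e - m (G.rev e)| :=
        (le_abs_self _).trans (hineq _ hγ hm.dstar_eq_zero)
    _ ≤ ∑ e, m e * h e := by
        rw [sum_eq_sum_orientation hO]
        refine Finset.sum_le_sum fun e _ => ?_
        rw [hsym e, ← add_mul, mul_comm]
        refine mul_le_mul_of_nonneg_right ?_ (hpos e)
        have h1 := hm.nonneg e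
        have h2 := hm.nonneg (G.rev e)
        exact abs_le.2 ⟨by linarith, by linarith⟩

/-- A connected graph whose closed walks all have nonnegative cost has a feasible potential. -/
lemma Connected.exists_potential (hconn : G.Connected) (c : G.EO → ℤ)
    (hc : ∀ u m, G.IsWalk u u m → 0 ≤ ∑ e, m e * c e) :
    ∃ f : G.V → ℤ, ∀ e, G.d f e ≤ c e := by
  rcases isEmpty_or_nonempty G.V with _ | ⟨⟨u⟩⟩
  · exact ⟨0, fun e => isEmptyElim (G.head e)⟩
  let S (v : G.V) : Set ℤ := {x | ∃ m, G.IsWalk u v m ∧ x = ∑ e, m e * c e}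
  have hbdd (v : G.V) : BddBelow (S v) := by
    obtain ⟨n, hn⟩ := hconn.exists_isWalk v u
    refine ⟨-∑ e, n e * c e, ?_⟩
    rintro _ ⟨m, hm, rfl⟩
    have := hc u _ (hm.trans hn)
    simp only [Pi.add_apply, add_mul, Finset.sum_add_distrib] at this
    linarith
  have hne (v : G.V) : (S v).Nonempty := by
    obtain ⟨m, hm⟩ := hconn.exists_isWalk u v
    exact ⟨_, m, hm, rfl⟩
  refine ⟨fun v => sInf (S v), fun e => ?_⟩
  obtain ⟨m, hm, hmin⟩ := Int.csInf_mem (hne (G.tail e)) (hbdd (G.tail e))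
  have hle : sInf (S (G.head e)) ≤ ∑ a, m a * c a + c e := by
    refine csInf_le (hbdd _) ⟨_, hm.snoc e, ?_⟩
    simp [add_mul, Finset.sum_add_distrib, Pi.single_apply]
  simp only [d]
  linarith

lemma IsCycle.sum_d {γ : List G.EO} (hγ : G.IsCycle γ) (f : G.V → ℤ) :
    (γ.map (G.d f)).sum = 0 := by
  obtain ⟨hne, hstep, -⟩ := hγ
  have : NeZero γ.length := ⟨by simpa using hne⟩
  have hsucc (i : Fin γ.length) : G.head (γ.get i) = G.tail (γ.get (i + 1)) := by
    rw [hstep i]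
    congr 2
    ext
    simp [Fin.val_add]
  have hsum := Equiv.sum_comp (Equiv.addRight (1 : Fin γ.length)) fun i => f (G.tail (γ.get i))
  simp only [Equiv.coe_addRight, ← hsucc] at hsum
  rw [← Fin.sum_univ_fun_getElem]
  simpa [d, sub_eq_zero] using hsum

/-- Coboundaries are orthogonal to `H^1`. -/
lemma sum_d_mul_eq_zero {O : Finset G.EO} (hO : ∀ e, e ∈ O ↔ G.rev e ∉ O)
    (f : G.V → ℤ) {γ : G.EO → ℤ} (hγ : G.IsC1 γ) (hd : G.dstar γ = 0) :
    ∑ e ∈ O, G.d f e * γ e = 0 := by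
  calc ∑ e ∈ O, G.d f e * γ e = ∑ e, f (G.head e) * γ e := by
        rw [sum_eq_sum_orientation hO]
        refine Finset.sum_congr rfl fun e _ => ?_
        rw [hγ e, G.head_rev, d]
        ring
    _ = ∑ v, f v * G.dstar γ v := by
        rw [← Finset.sum_fiberwise Finset.univ G.head]
        refine Finset.sum_congr rfl fun v _ => ?_
        rw [dstar, Finset.mul_sum]
        refine Finset.sum_congr (by ext; simp) fun e he => ?_
        rw [(Finset.mem_filter.1 he).2]
    _ = 0 := by simp [hd]

/-- A potential that is feasible for the cost `h - β` is tight on every cycle of cost zero. -/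
lemma IsCycle.d_eq {γ : List G.EO} (hγ : G.IsCycle γ) {β h : G.EO → ℤ} {f : G.V → ℤ}
    (hf : ∀ e, G.d f e ≤ h e - β e) (hsum : (γ.map β).sum = (γ.map h).sum)
    {e : G.EO} (he : e ∈ γ) : G.d f e = h e - β e := by
  have h0 := hγ.sum_d f
  rw [← Fin.sum_univ_fun_getElem] at h0 hsum
  rw [← Fin.sum_univ_fun_getElem] at hsum
  have h1 : ∑ i : Fin γ.length, (h γ[i.1] - β γ[i.1] - G.d f γ[i.1]) = 0 := by
    simp only [Finset.sum_sub_distrib]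
    linarith
  rw [Finset.sum_eq_zero_iff_of_nonneg fun i _ => sub_nonneg.2 (hf _)] at h1
  obtain ⟨i, hi, rfl⟩ := List.getElem_of_mem he
  exact (sub_eq_zero.1 (h1 ⟨i, hi⟩ (Finset.mem_univ _))).symm

end OrGraph

/-- assuming moreover that every edge with `h(e) > 0` has an
orientation in `A`, the 1-cochain `η` equal to `±h` on `A` and its reversal and
`0` elsewhere satisfies `∑ β_e γ_e = ∑ η_e γ_e` for all `γ ∈ H^1(G,ℤ)`. -/
theorem eta_from_A_works (G : OrGraph) (hconn : G.Connected)
    (O : Finset G.EO) (hO : ∀ e, e ∈ O ↔ G.rev e ∉ O)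
    (β : G.EO → ℤ) (hβ : G.IsC1 β)
    (h : G.EO → ℤ) (hsym : ∀ e, h (G.rev e) = h e) (hpos : ∀ e, 0 ≤ h e)
    (hineq : ∀ γ : G.EO → ℤ, G.IsC1 γ → G.dstar γ = 0 →
      |∑ e ∈ O, β e * γ e| ≤ ∑ e ∈ O, h e * |γ e|)
    (A : Set G.EO)
    (hAdef : ∀ e, e ∈ A ↔ ∃ γ : List G.EO, G.IsCycle γ ∧ e ∈ γ ∧
      (γ.map β).sum = (γ.map h).sum)
    (hcover : ∀ e, 0 < h e → e ∈ A ∨ G.rev e ∈ A)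
    (η : G.EO → ℤ)
    (hη1 : ∀ e, 0 < h e → e ∈ A → η e = h e)
    (hη2 : ∀ e, 0 < h e → G.rev e ∈ A → η e = - h e)
    (hη3 : ∀ e, ¬(0 < h e ∧ (e ∈ A ∨ G.rev e ∈ A)) → η e = 0) :
    ∀ γ : G.EO → ℤ, G.IsC1 γ → G.dstar γ = 0 →
      ∑ e ∈ O, β e * γ e = ∑ e ∈ O, η e * γ e := by
  intro γ hγ hγ0
  obtain ⟨f, hf⟩ := hconn.exists_potential (fun e => h e - β e) fun u m hm => by
    have := hm.sum_le_sum hO hβ hsym hpos hineq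
    simp only [mul_sub, Finset.sum_sub_distrib]
    linarith
  have htight (e : G.EO) (he : e ∈ A) : G.d f e = h e - β e := by
    obtain ⟨c, hc, hec, hsum⟩ := (hAdef e).1 he
    exact hc.d_eq hf hsum hec
  have hd_rev (e : G.EO) : G.d f (G.rev e) = -G.d f e := by
    simp [OrGraph.d, G.head_rev, G.tail_rev]
  have hη (e : G.EO) : η e = β e + G.d f e := by
    by_cases he : 0 < h e
    · rcases hcover e he with hA | hA
      · rw [hη1 e he hA, htight e hA]
        ring
      · have := htight _ hA
        rw [hd_rev, hβ e, hsym] at this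
        rw [hη2 e he hA]
        linarith
    · have h1 := hf e
      have h2 := hf (G.rev e)
      rw [hd_rev, hβ e, hsym] at h2
      rw [hη3 e fun h' => he h'.1]
      linarith [hpos e]
  simp only [hη, add_mul, Finset.sum_add_distrib, OrGraph.sum_d_mul_eq_zero hO f hγ hγ0, add_zero]
end

section
/- Let κ be a field and for each i ∈ ℤ let (x_i : y_i) be a point of the projective line ℙ¹(κ) (so (x_i, y_i) ≠ (0,0), defined up to a common nonzero scalar). Assume there exist indices i, j ∈ ℤ with x_i ≠ 0 and y_j ≠ 0. Then the family satisfies x_i·y_j = 0 for all pairs i < j if and only if there exists ℓ ∈ ℤ such that x_m = 0 for every m < ℓ and y_m = 0 for every m > ℓ. (In other words, the subset of ∏_{i∈ℤ} ℙ¹(κ) minus the two constant points (0:1)^ℤ and (1:0)^ℤ cut out by the equations x_i y_j = 0 for i < j is exactly the doubly infinite chain of projective lines ∪_{ℓ∈ℤ} ℙ¹_ℓ, where ℙ¹_ℓ is the set of families with (x_m:y_m) = (0:1) for m < ℓ and (x_m:y_m) = (1:0) for m > ℓ.) -/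
/-- a doubly infinite family of points `(x_i : y_i)` of `ℙ¹(κ)`,
not all `(0:1)` nor all `(1:0)`, satisfies the equations `x_i y_j = 0` for all
`i < j` if and only if it lies on the doubly infinite chain of projective
lines, i.e. there is `ℓ ∈ ℤ` with `x_m = 0` for `m < ℓ` and `y_m = 0` for
`m > ℓ`. -/
theorem chain_of_projective_lines (κ : Type) [Field κ]
    (x y : ℤ → κ) (hpt : ∀ i, ¬(x i = 0 ∧ y i = 0))
    (hx : ∃ i, x i ≠ 0) (hy : ∃ j, y j ≠ 0) :
    (∀ i j : ℤ, i < j → x i * y j = 0) ↔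
      ∃ l : ℤ, (∀ m, m < l → x m = 0) ∧ (∀ m, l < m → y m = 0) := by
  constructor
  · intro h
    obtain ⟨j, hj⟩ := hy
    have hbdd : ∀ i, x i ≠ 0 → j ≤ i := fun i hi =>
      not_lt.mp fun hij => mul_ne_zero hi hj (h i j hij)
    obtain ⟨l, hl, hmin⟩ := Int.exists_least_of_bdd ⟨j, hbdd⟩ hx
    exact ⟨l, fun m hm => by_contra fun hne => (hmin m hne).not_gt hm,
      fun m hm => (mul_eq_zero.mp (h l m hm)).resolve_left hl⟩
  · rintro ⟨l, hxl, hyl⟩ i j hij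
    rcases lt_or_ge i l with hi | hi
    · rw [hxl i hi, zero_mul]
    · rw [hyl j (hi.trans_lt hij), mul_zero]
end
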